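/- If ⟨A1,L1⟩ and ⟨A2,L2⟩ are arguments with A1 ⊆ A2 and L1 = L2, then ⟨A1,L1⟩ ≲CP ⟨A2,L2⟩. -/

import Mathlib

/-- A literal: an atom, possibly prefixed with negation. -/
inductive Lit (α : Type) : Type where
  | pos : α → Lit α
  | neg : α → Lit α
  deriving DecidableEq

/-- A (ground) rule: a head literal together with a finite (possibly empty)
conjunction of body literals.  A rule with empty body is just a literal. -/
structure Rule (α : Type) : Type where
  head : Lit α
  body : Finset (Lit α)
  deriving DecidableEq

/-- View a set of literals as a set of bodiless rules. -/
def litRules {α : Type} (S : Set (Lit α)) : Set (Rule α) :=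
  {r | r.head ∈ S ∧ r.body = ∅}

/-- The theory `𝔗_P` of a set of rules `P`: the least set of literals
containing the bodiless rules of `P` and closed under the rules of `P`. -/
inductive Th {α : Type} (P : Set (Rule α)) : Lit α → Prop where
  | step (r : Rule α) (hr : r ∈ P) (ih : ∀ l ∈ r.body, Th P l) : Th P r.head

/-- A set of rules is contradictory iff it derives both `A` and `¬A`
for some atom `A`. -/
def Contradictory {α : Type} (P : Set (Rule α)) : Prop :=
  ∃ a : α, Th P (Lit.pos a) ∧ Th P (Lit.neg a)

/-- A defeasible specification `⟨Π^F, Π^G, Δ⟩`: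
facts, general (strict) rules, and defeasible rules (all taken ground). -/
structure Spec (α : Type) : Type where
  F : Set (Lit α)
  G : Set (Rule α)
  D : Set (Rule α)

namespace Spec

variable {α : Type}

/-- `Π := Π^F ∪ Π^G`. -/
def strict (S : Spec α) : Set (Rule α) := litRules S.F ∪ S.G

/-- `𝔗_Π`. -/
def ThStrict (S : Spec α) : Set (Lit α) := {l | Th S.strict l}

/-- `𝔗_{Π ∪ Δ}`. -/
def ThAll (S : Spec α) : Set (Lit α) := {l | Th (S.strict ∪ S.D) l}

/-- `⟨A, L⟩` is an argument: `A` is a set of (ground instances of) defeasible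
rules from `Δ` and `A ∪ Π` derives `L`. -/
def IsArgument (S : Spec α) (A : Set (Rule α)) (L : Lit α) : Prop :=
  A ⊆ S.D ∧ Th (A ∪ S.strict) L

/-- `H` is a simplified activation set for `⟨A, L⟩`:  `L ∈ 𝔗_{H ∪ A ∪ Π^G}`. -/
def SAct (S : Spec α) (A : Set (Rule α)) (L : Lit α) (H : Set (Lit α)) : Prop :=
  Th (litRules H ∪ A ∪ S.G) L

/-- `H` is an activation set for `⟨A, L⟩`:
`L ∈ 𝔗_{𝔏 ∪ Π}` for some `𝔏 ⊆ 𝔗_{H ∪ A ∪ Π^G}`. -/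
def Act (S : Spec α) (A : Set (Rule α)) (L : Lit α) (H : Set (Lit α)) : Prop :=
  ∃ Ls : Set (Lit α), Ls ⊆ {l | Th (litRules H ∪ A ∪ S.G) l} ∧
    Th (litRules Ls ∪ S.strict) L

/-- `H` is a minimal simplified activation set for `⟨A, L⟩`. -/
def MinSAct (S : Spec α) (A : Set (Rule α)) (L : Lit α) (H : Set (Lit α)) : Prop :=
  S.SAct A L H ∧ ∀ H' ⊂ H, ¬ S.SAct A L H'

/-- `H` is a minimal activation set for `⟨A, L⟩`. -/
def MinAct (S : Spec α) (A : Set (Rule α)) (L : Lit α) (H : Set (Lit α)) : Prop :=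
  S.Act A L H ∧ ∀ H' ⊂ H, ¬ S.Act A L H'

/-- Poole's original specificity relation `≲P1`. -/
def leP1 (S : Spec α) (X Y : Set (Rule α) × Lit α) : Prop :=
  S.IsArgument X.1 X.2 ∧ S.IsArgument Y.1 Y.2 ∧
    ∀ H ⊆ S.ThAll, S.SAct X.1 X.2 H → ¬ S.SAct Y.1 X.2 H → S.SAct Y.1 Y.2 H

/-- The standard version `≲P2` of Poole's specificity. -/
def leP2 (S : Spec α) (X Y : Set (Rule α) × Lit α) : Prop :=
  S.IsArgument X.1 X.2 ∧ S.IsArgument Y.1 Y.2 ∧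
    ∀ H ⊆ S.ThAll, S.SAct X.1 X.2 H → ¬ S.SAct ∅ X.2 H → S.SAct Y.1 Y.2 H

/-- The rather unflawed version `≲P3` of Poole's specificity. -/
def leP3 (S : Spec α) (X Y : Set (Rule α) × Lit α) : Prop :=
  S.IsArgument X.1 X.2 ∧ S.IsArgument Y.1 Y.2 ∧
    (Y.2 ∈ S.ThStrict → X.2 ∈ S.ThStrict) ∧
    ∀ H ⊆ S.ThAll, S.SAct X.1 X.2 H → ¬ S.SAct ∅ X.2 H → S.SAct Y.1 Y.2 H

/-- The corrected specificity relation `≲CP`. -/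
def leCP (S : Spec α) (X Y : Set (Rule α) × Lit α) : Prop :=
  S.IsArgument X.1 X.2 ∧ S.IsArgument Y.1 Y.2 ∧
    (X.2 ∈ S.ThStrict ∨
      (Y.2 ∉ S.ThStrict ∧
        ∀ H ⊆ S.ThStrict, S.Act X.1 X.2 H → S.Act Y.1 Y.2 H))

/-- `<P1 := ≲P1 \ ≳P1`. -/
def ltP1 (S : Spec α) (X Y : Set (Rule α) × Lit α) : Prop := S.leP1 X Y ∧ ¬ S.leP1 Y X
/-- `<P2 := ≲P2 \ ≳P2`. -/
def ltP2 (S : Spec α) (X Y : Set (Rule α) × Lit α) : Prop := S.leP2 X Y ∧ ¬ S.leP2 Y X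
/-- `<P3 := ≲P3 \ ≳P3`. -/
def ltP3 (S : Spec α) (X Y : Set (Rule α) × Lit α) : Prop := S.leP3 X Y ∧ ¬ S.leP3 Y X
/-- `<CP := ≲CP \ ≳CP`. -/
def ltCP (S : Spec α) (X Y : Set (Rule α) × Lit α) : Prop := S.leCP X Y ∧ ¬ S.leCP Y X

/-- `Π^{<2}`: rules of `Π` with at most one body literal. -/
def strictLt2 (S : Spec α) : Set (Rule α) := {r ∈ S.strict | r.body.card ≤ 1}

/-- `Π^{≥2}`: rules of `Π` with at least two body literals. -/
def strictGe2 (S : Spec α) : Set (Rule α) := {r ∈ S.strict | 2 ≤ r.body.card}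

/-- Condition 1 of Theorem 16. -/
def Cond1 (S : Spec α) : Prop :=
  ∀ H ⊆ S.ThStrict, ∀ A ⊆ S.D,
    {l | Th (litRules {l | Th (litRules H ∪ A ∪ S.G) l} ∪ S.strict) l} ⊆
      {l | Th (litRules H ∪ A ∪ S.G) l} ∪ S.ThStrict

/-- Condition 2 of Theorem 16. -/
def Cond2 (S : Spec α) : Prop :=
  ∀ r ∈ S.strictGe2, r.head ∉ {l | Th S.strictLt2 l} →
    ∀ l ∈ r.body, l ∉ {l | Th S.strictLt2 l}

/-- Condition 3 of Theorem 16. -/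
def Cond3 (S : Spec α) : Prop :=
  ∀ r ∈ S.strictGe2, ∀ l ∈ r.body, l ∉ S.ThStrict

/-- Condition 4 of Theorem 16. -/
def Cond4 (S : Spec α) : Prop := S.strictGe2 = ∅

end Spec

/-- The theory of a set of rules is monotone in the set of rules. -/
theorem Th.mono {α : Type} {P Q : Set (Rule α)} (hPQ : P ⊆ Q) {l : Lit α} (h : Th P l) :
    Th Q l := by
  induction h with
  | step r hr _ ih => exact Th.step r (hPQ hr) ih

/-- Activation sets remain activation sets when the argument's rules are enlarged. -/
theorem Spec.Act.mono {α : Type} {S : Spec α} {A B : Set (Rule α)} (hAB : A ⊆ B) {L : Lit α}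
    {H : Set (Lit α)} (h : S.Act A L H) : S.Act B L H := by
  obtain ⟨Ls, hLs, hL⟩ := h
  exact ⟨Ls, fun l hl => Th.mono
    (Set.union_subset_union_left _ (Set.union_subset_union_right _ hAB)) (hLs hl), hL⟩

/-- Corollary 18: sub-arguments are more (or equivalently) specific w.r.t. `≲CP`. -/
theorem leCP_of_subset {α : Type} (S : Spec α) (A1 A2 : Set (Rule α)) (L1 L2 : Lit α)
    (h1 : S.IsArgument A1 L1) (h2 : S.IsArgument A2 L2)
    (hsub : A1 ⊆ A2) (heq : L1 = L2) :
    S.leCP (A1, L1) (A2, L2) := by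
  subst heq
  by_cases h : L1 ∈ S.ThStrict
  · exact ⟨h1, h2, Or.inl h⟩
  · exact ⟨h1, h2, Or.inr ⟨h, fun _ _ hH => hH.mono hsub⟩⟩
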